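/- Let λ > 0 and let δ be a real number with −1 < δ < 2. Suppose u : {(x,y) ∈ ℝ² : x > 0} → ℝ is twice continuously differentiable, satisfies −x²(∂²u/∂x² + ∂²u/∂y²) + 2·λ²·x²·E(λx)·u = 0 at every point of the half-plane, where E(s) = tanh(s)² + tanh(s)^(−2), and satisfies |u(x,y)| ≤ x^δ for all x > 0 and all y ∈ ℝ. Then u is identically zero. -/

import Mathlib

/-- `E(s) = tanh(s)² + tanh(s)^(-2)`. -/
noncomputable def modelE (s : ℝ) : ℝ := Real.tanh s ^ 2 + (Real.tanh s ^ 2)⁻¹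

open Topology in
/-- The second derivative is non-positive at a local maximum. -/
theorem IsLocalMax.iteratedDeriv_two_nonpos {f : ℝ → ℝ} {a : ℝ} (h : IsLocalMax f a)
    (hc : ContinuousAt f a) : iteratedDeriv 2 f a ≤ 0 := by
  rw [iteratedDeriv_succ, iteratedDeriv_one]
  by_contra! hpos
  have hmin := isLocalMin_of_deriv_deriv_pos hpos h.deriv_eq_zero hc
  have hconst : f =ᶠ[𝓝 a] fun _ => f a := by
    filter_upwards [h, hmin] with s h₁ h₂ using le_antisymm h₁ h₂
  have hderiv : deriv f =ᶠ[𝓝 a] fun _ => 0 := by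
    simpa using hconst.deriv
  simp [hderiv.deriv_eq] at hpos

theorem Real.sinh_le_mul_cosh {s : ℝ} (hs : 0 ≤ s) : sinh s ≤ s * cosh s := by
  have hd (t : ℝ) : HasDerivAt (fun t => t * cosh t - sinh t) (t * sinh t) t := by
    refine (((hasDerivAt_id t).mul (hasDerivAt_cosh t)).sub (hasDerivAt_sinh t)).congr_deriv ?_
    simp
  have hmono : MonotoneOn (fun t => t * cosh t - sinh t) (Set.Ici 0) := by
    refine monotoneOn_of_deriv_nonneg (convex_Ici 0)
      (fun t _ => (hd t).continuousAt.continuousWithinAt)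
      (fun t _ => (hd t).differentiableAt.differentiableWithinAt) fun t ht => ?_
    rw [interior_Ici] at ht
    rw [(hd t).deriv]
    exact mul_nonneg ht.le (sinh_nonneg_iff.2 ht.le)
  have h := hmono Set.self_mem_Ici hs hs
  simp only [zero_mul, sinh_zero, sub_zero] at h
  linarith

theorem Real.tanh_pos_of_pos {s : ℝ} (hs : 0 < s) : 0 < tanh s := by
  rw [tanh_eq_sinh_div_cosh]
  exact div_pos (sinh_pos_iff.2 hs) (cosh_pos s)

theorem inv_sq_le_modelE {s : ℝ} (hs : 0 < s) : (s ^ 2)⁻¹ ≤ modelE s := by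
  have hpos := Real.tanh_pos_of_pos hs
  have hle : Real.tanh s ≤ s := by
    rw [Real.tanh_eq_sinh_div_cosh, div_le_iff₀ (Real.cosh_pos s)]
    exact Real.sinh_le_mul_cosh hs.le
  have : (s ^ 2)⁻¹ ≤ (Real.tanh s ^ 2)⁻¹ := by gcongr
  unfold modelE
  linarith [sq_nonneg (Real.tanh s)]

theorem one_le_modelE {s : ℝ} (hs : 0 < s) : 1 ≤ modelE s := by
  have hpos : 0 < Real.tanh s ^ 2 := pow_pos (Real.tanh_pos_of_pos hs) 2
  have hle : Real.tanh s ^ 2 ≤ 1 := by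
    nlinarith [Real.tanh_lt_one s, Real.tanh_pos_of_pos hs]
  have := (one_le_inv₀ hpos).2 hle
  unfold modelE
  linarith

/-- A positive supersolution of the model equation, growing faster than `x ^ δ` at every end of
the half-plane when `-1 < δ`. -/
noncomputable def barrier (lam x y : ℝ) : ℝ :=
  x⁻¹ + Real.cosh (lam * x) * Real.cosh (lam * y)

theorem barrier_pos (lam : ℝ) {x : ℝ} (hx : 0 < x) (y : ℝ) : 0 < barrier lam x y :=
  add_pos (inv_pos.2 hx) (mul_pos (Real.cosh_pos _) (Real.cosh_pos _))

theorem contDiffAt_barrier_left (lam : ℝ) {x : ℝ} (hx : 0 < x) (y : ℝ) :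
    ContDiffAt ℝ 2 (fun s => barrier lam s y) x := by
  unfold barrier
  have : x ≠ 0 := hx.ne'
  fun_prop (disch := assumption)

theorem contDiffAt_barrier_right (lam x y : ℝ) :
    ContDiffAt ℝ 2 (fun s => barrier lam x s) y := by
  unfold barrier
  fun_prop

theorem hasDerivAt_cosh_mul (lam s : ℝ) :
    HasDerivAt (fun t => Real.cosh (lam * t)) (lam * Real.sinh (lam * s)) s := by
  simpa [mul_comm] using ((hasDerivAt_id s).const_mul lam).cosh

theorem hasDerivAt_sinh_mul (lam s : ℝ) :
    HasDerivAt (fun t => Real.sinh (lam * t)) (lam * Real.cosh (lam * s)) s := by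
  simpa [mul_comm] using ((hasDerivAt_id s).const_mul lam).sinh

open Topology in
theorem iteratedDeriv_two_barrier_left (lam : ℝ) {x : ℝ} (hx : 0 < x) (y : ℝ) :
    iteratedDeriv 2 (fun s => barrier lam s y) x
      = 2 * (x ^ 3)⁻¹ + lam ^ 2 * (Real.cosh (lam * x) * Real.cosh (lam * y)) := by
  have h₁ : deriv (fun s => barrier lam s y) =ᶠ[𝓝 x]
      fun s => -(s ^ 2)⁻¹ + lam * Real.sinh (lam * s) * Real.cosh (lam * y) := by
    filter_upwards [lt_mem_nhds hx] with s hs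
    exact ((hasDerivAt_inv hs.ne').add ((hasDerivAt_cosh_mul lam s).mul_const _)).deriv
  have h₂ : HasDerivAt (fun s => -(s ^ 2)⁻¹ + lam * Real.sinh (lam * s) * Real.cosh (lam * y))
      (2 * (x ^ 3)⁻¹ + lam ^ 2 * (Real.cosh (lam * x) * Real.cosh (lam * y))) x := by
    refine ((((hasDerivAt_pow 2 x).inv (pow_ne_zero 2 hx.ne')).neg).add
      (((hasDerivAt_sinh_mul lam x).const_mul lam).mul_const (Real.cosh (lam * y)))).congr_deriv ?_
    field_simp
    norm_num
    ring
  rw [iteratedDeriv_succ, iteratedDeriv_one, h₁.deriv_eq, h₂.deriv]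

theorem iteratedDeriv_two_barrier_right (lam x y : ℝ) :
    iteratedDeriv 2 (fun s => barrier lam x s) y
      = lam ^ 2 * (Real.cosh (lam * x) * Real.cosh (lam * y)) := by
  have h₁ : deriv (fun s => barrier lam x s)
      = fun s => Real.cosh (lam * x) * (lam * Real.sinh (lam * s)) := by
    funext s
    exact (((hasDerivAt_cosh_mul lam s).const_mul _).const_add _).deriv
  rw [iteratedDeriv_succ, iteratedDeriv_one, h₁,
    (((hasDerivAt_sinh_mul lam y).const_mul lam).const_mul _).deriv]
  ring

theorem laplacian_barrier_le {lam x : ℝ} (hlam : 0 < lam) (hx : 0 < x) (y : ℝ) :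
    iteratedDeriv 2 (fun s => barrier lam s y) x + iteratedDeriv 2 (fun s => barrier lam x s) y
      ≤ 2 * lam ^ 2 * modelE (lam * x) * barrier lam x y := by
  rw [iteratedDeriv_two_barrier_left lam hx, iteratedDeriv_two_barrier_right]
  have hs : 0 < lam * x := mul_pos hlam hx
  have h₁ := mul_le_mul_of_nonneg_left (inv_sq_le_modelE hs)
    (by positivity : 0 ≤ 2 * lam ^ 2 * x⁻¹)
  have h₂ := mul_le_mul_of_nonneg_left (one_le_modelE hs)
    (by positivity : 0 ≤ 2 * lam ^ 2 * (Real.cosh (lam * x) * Real.cosh (lam * y)))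
  have h₃ : 2 * lam ^ 2 * x⁻¹ * ((lam * x) ^ 2)⁻¹ = 2 * (x ^ 3)⁻¹ := by
    field_simp
  unfold barrier
  linarith

open Filter Topology Set in
/-- Outside a compact part of the half-plane, `x ^ δ` is dominated by any multiple of the
barrier. -/
theorem exists_rpow_le_barrier {lam δ ε : ℝ} (hlam : 0 < lam) (hδ : -1 < δ) (hε : 0 < ε) :
    ∃ a b Y : ℝ, 0 < a ∧ ∀ x y : ℝ, 0 < x → (x, y) ∉ Icc a b ×ˢ Icc (-Y) Y →
      x ^ δ ≤ ε * barrier lam x y := by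
  obtain ⟨a, ha, hleft⟩ : ∃ a > 0, ∀ x, 0 < x → x < a → x ^ δ ≤ ε * x⁻¹ := by
    have hlim : Tendsto (fun x : ℝ => x ^ (δ + 1)) (𝓝 0) (𝓝 0) := by
      have hpos : 0 < δ + 1 := by linarith
      simpa [Real.zero_rpow hpos.ne'] using
        (Real.continuousAt_rpow_const 0 _ (Or.inr hpos.le)).tendsto
    obtain ⟨a, ha, h⟩ := Metric.eventually_nhds_iff.1 (hlim.eventually (gt_mem_nhds hε))
    refine ⟨a, ha, fun x hx hxa => ?_⟩
    have := h (y := x) (by simpa [abs_of_pos hx] using hxa)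
    rw [Real.rpow_add_one hx.ne'] at this
    rw [← div_eq_mul_inv, le_div_iff₀ hx]
    exact this.le
  obtain ⟨b, hright⟩ : ∃ b, ∀ x, 0 < x → b ≤ x → x ^ δ ≤ ε * Real.cosh (lam * x) := by
    obtain ⟨b, h⟩ := eventually_atTop.1
      ((isLittleO_rpow_exp_pos_mul_atTop δ hlam).bound (half_pos hε))
    refine ⟨b, fun x hx hbx => ?_⟩
    have h₁ := (le_abs_self _).trans (h x hbx)
    rw [Real.norm_of_nonneg (Real.exp_pos _).le] at h₁
    rw [Real.cosh_eq]
    nlinarith [Real.exp_pos (-(lam * x))]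
  obtain ⟨M, hM⟩ : ∃ M, ∀ x ∈ Icc a b, x ^ δ ≤ M := by
    have hcont : ContinuousOn (fun x : ℝ => x ^ δ) (Icc a b) := fun x hx =>
      (Real.continuousAt_rpow_const x δ
        (Or.inl (ha.trans_le hx.1).ne')).continuousWithinAt
    obtain ⟨M, h⟩ := isCompact_Icc.bddAbove_image hcont
    exact ⟨M, fun x hx => h (mem_image_of_mem _ hx)⟩
  refine ⟨a, b, 2 * M / (ε * lam), ha, fun x y hx hxy => ?_⟩
  have hinv := inv_pos.2 hx
  have hcx := Real.one_le_cosh (lam * x)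
  have hcy := Real.one_le_cosh (lam * y)
  rcases lt_or_ge x a with hxa | hxa
  · refine (hleft x hx hxa).trans ?_
    unfold barrier
    gcongr
    nlinarith
  rcases lt_or_ge b x with hbx | hbx
  · refine (hright x hx hbx.le).trans ?_
    unfold barrier
    gcongr
    nlinarith
  have hy : 2 * M / (ε * lam) < |y| := by
    by_contra! h
    exact hxy ⟨⟨hxa, hbx⟩, abs_le.1 h⟩
  rw [div_lt_iff₀ (by positivity)] at hy
  have hcosh : lam * |y| / 2 ≤ Real.cosh (lam * y) := by
    rw [← Real.cosh_abs, abs_mul, abs_of_pos hlam, Real.cosh_eq]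
    nlinarith [Real.add_one_le_exp (lam * |y|), Real.exp_pos (-(lam * |y|))]
  calc x ^ δ ≤ M := hM x ⟨hxa, hbx⟩
    _ ≤ ε * (lam * |y| / 2) := by linarith
    _ ≤ ε * barrier lam x y := by
      unfold barrier
      gcongr
      nlinarith

open Filter Topology Set in
/-- Comparison principle: a solution bounded above by `x ^ δ` lies below every positive multiple
of the barrier. -/
theorem le_barrier_of_solution {lam δ ε : ℝ} (hlam : 0 < lam) (hδ : -1 < δ) (hε : 0 < ε)
    {u : ℝ → ℝ → ℝ}
    (hreg : ContDiffOn ℝ 2 (fun p : ℝ × ℝ => u p.1 p.2) {p : ℝ × ℝ | 0 < p.1})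
    (hpde : ∀ x y : ℝ, 0 < x →
      iteratedDeriv 2 (fun s => u s y) x + iteratedDeriv 2 (fun s => u x s) y
        = 2 * lam ^ 2 * modelE (lam * x) * u x y)
    (hbd : ∀ x y : ℝ, 0 < x → u x y ≤ x ^ δ) (x₀ y₀ : ℝ) (hx₀ : 0 < x₀) :
    u x₀ y₀ ≤ ε * barrier lam x₀ y₀ := by
  by_contra! hlt
  set v : ℝ × ℝ → ℝ := fun p => u p.1 p.2 - ε * barrier lam p.1 p.2
  obtain ⟨a, b, Y, ha, hout⟩ := exists_rpow_le_barrier hlam hδ hε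
  set K : Set (ℝ × ℝ) := Icc a b ×ˢ Icc (-Y) Y
  have hout' (p : ℝ × ℝ) (hp : 0 < p.1) (hpK : p ∉ K) : v p ≤ 0 :=
    sub_nonpos.2 ((hbd p.1 p.2 hp).trans (hout p.1 p.2 hp hpK))
  have hv₀ : 0 < v (x₀, y₀) := sub_pos.2 hlt
  have hK₀ : (x₀, y₀) ∈ K := by
    by_contra h
    exact hv₀.not_ge (hout' _ hx₀ h)
  have hKpos : ∀ p ∈ K, 0 < p.1 := fun p hp => ha.trans_le hp.1.1
  have hopen : IsOpen {p : ℝ × ℝ | 0 < p.1} := isOpen_lt continuous_const continuous_fst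
  have hu (p : ℝ × ℝ) (hp : 0 < p.1) : ContDiffAt ℝ 2 (fun p : ℝ × ℝ => u p.1 p.2) p :=
    hreg.contDiffAt (hopen.mem_nhds hp)
  have hvcont (p : ℝ × ℝ) (hp : 0 < p.1) : ContinuousAt v p := by
    have hp' : p.1 ≠ 0 := hp.ne'
    refine (hu p hp).continuousAt.sub ?_
    unfold barrier
    fun_prop (disch := assumption)
  obtain ⟨⟨x, y⟩, hmem, hmax⟩ := (isCompact_Icc.prod isCompact_Icc).exists_isMaxOn ⟨_, hK₀⟩
    (fun p hp => (hvcont p (hKpos p hp)).continuousWithinAt : ContinuousOn v K)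
  have hx : 0 < x := hKpos _ hmem
  have hvpos : 0 < v (x, y) := hv₀.trans_le (hmax hK₀)
  have hloc : IsLocalMax v (x, y) := by
    filter_upwards [hopen.mem_nhds hx] with p hp
    by_cases hpK : p ∈ K
    · exact hmax hpK
    · exact (hout' p hp hpK).trans hvpos.le
  have hux : ContDiffAt ℝ 2 (fun s => u s y) x :=
    (hu (x, y) hx).comp x (contDiffAt_id.prodMk contDiffAt_const)
  have huy : ContDiffAt ℝ 2 (fun s => u x s) y :=
    (hu (x, y) hx).comp y (contDiffAt_const.prodMk contDiffAt_id)
  have hwx : ContDiffAt ℝ 2 (fun s => ε * barrier lam s y) x :=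
    contDiffAt_const.mul (contDiffAt_barrier_left lam hx y)
  have hwy : ContDiffAt ℝ 2 (fun s => ε * barrier lam x s) y :=
    contDiffAt_const.mul (contDiffAt_barrier_right lam x y)
  have hdx : iteratedDeriv 2 (fun s => u s y - ε * barrier lam s y) x ≤ 0 :=
    IsLocalMax.iteratedDeriv_two_nonpos
      (hloc.comp_continuous (g := fun s => (s, y)) (b := x) (by fun_prop))
      (hux.sub hwx).continuousAt
  have hdy : iteratedDeriv 2 (fun s => u x s - ε * barrier lam x s) y ≤ 0 :=
    IsLocalMax.iteratedDeriv_two_nonpos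
      (hloc.comp_continuous (g := fun s => (x, s)) (b := y) (by fun_prop))
      (huy.sub hwy).continuousAt
  rw [iteratedDeriv_fun_sub hux hwx, iteratedDeriv_const_mul_field] at hdx
  rw [iteratedDeriv_fun_sub huy hwy, iteratedDeriv_const_mul_field] at hdy
  have hlap := mul_le_mul_of_nonneg_left (laplacian_barrier_le hlam hx y) hε.le
  have hE := one_le_modelE (mul_pos hlam hx)
  have hpos : 0 < 2 * lam ^ 2 * modelE (lam * x) * (u x y - ε * barrier lam x y) :=
    mul_pos (by positivity) hvpos
  linarith [hpde x y hx]

/-- Vanishing of solutions of the diagonal model equation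
`Δ u + 2 λ² x² E(λx) u = 0` on the hyperbolic half-plane which satisfy `|u| ≤ x^δ`
with `-1 < δ < 2`. -/
theorem trivial_kernel_model_space_diag
    (lam δ : ℝ) (hlam : 0 < lam) (hδl : -1 < δ) (hδu : δ < 2)
    (u : ℝ → ℝ → ℝ)
    (hreg : ContDiffOn ℝ 2 (fun p : ℝ × ℝ => u p.1 p.2) {p : ℝ × ℝ | 0 < p.1})
    (hpde : ∀ x y : ℝ, 0 < x →
      -(x ^ 2) * (iteratedDeriv 2 (fun s => u s y) x + iteratedDeriv 2 (fun s => u x s) y)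
        + 2 * lam ^ 2 * x ^ 2 * modelE (lam * x) * u x y = 0)
    (hbd : ∀ x y : ℝ, 0 < x → |u x y| ≤ x ^ δ) :
    ∀ x y : ℝ, 0 < x → u x y = 0 := by
  have heq (x y : ℝ) (hx : 0 < x) :
      iteratedDeriv 2 (fun s => u s y) x + iteratedDeriv 2 (fun s => u x s) y
        = 2 * lam ^ 2 * modelE (lam * x) * u x y := by
    refine mul_left_cancel₀ (pow_ne_zero 2 hx.ne') ?_
    linarith [hpde x y hx]
  have heq_neg (x y : ℝ) (hx : 0 < x) :
      iteratedDeriv 2 (fun s => -u s y) x + iteratedDeriv 2 (fun s => -u x s) y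
        = 2 * lam ^ 2 * modelE (lam * x) * -u x y := by
    rw [iteratedDeriv_fun_neg, iteratedDeriv_fun_neg]
    linarith [heq x y hx]
  intro x y hx
  refine abs_nonpos_iff.1 (le_of_forall_pos_le_add fun η hη => ?_)
  have hb := barrier_pos lam hx y
  have hε : 0 < η / barrier lam x y := div_pos hη hb
  have h₁ := le_barrier_of_solution hlam hδl hε hreg heq
    (fun x y hx => (le_abs_self _).trans (hbd x y hx)) x y hx
  have h₂ := le_barrier_of_solution (u := fun x y => -u x y) hlam hδl hε hreg.neg heq_neg
    (fun x y hx => (neg_le_abs _).trans (hbd x y hx)) x y hx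
  rw [div_mul_cancel₀ _ hb.ne'] at h₁ h₂
  rw [zero_add]
  exact abs_le'.2 ⟨h₁, h₂⟩
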